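/- arXiv:0805.4472 — 2 statements merged into one kernel-verified Lean document; each statement's English description precedes it below -/
import Mathlib

section
/- For every t ∈ ℝ, T > 0 and every complex z with |z| ≤ 1, the generating function q^{(σ)}(z) = Π_{i∈ℤ} (1 + (z-1)·p_i(t,t+T)) of the number of PSRA arrivals in (t,t+T] converges, as σ → ∞, to the generating function exp(λT(z-1)) of the Poisson distribution with intensity λT. -/
open MeasureTheory Filter

/-- The probability that client `i` of a PSRA process arrives in `(a, b]`. -/
noncomputable def arrivalProb (lam : ℝ) (f : ℝ → ℝ) (a b σ : ℝ) (i : ℤ) : ℝ :=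
  ∫ x in a..b, (1 / σ) * f ((x - i / lam) / σ)

section ArrivalProb

variable {lam : ℝ} {f : ℝ → ℝ}

lemma continuous_arrivalDensity (hf : Continuous f) (σ : ℝ) (i : ℤ) :
    Continuous fun x : ℝ => (1 / σ) * f ((x - i / lam) / σ) := by
  fun_prop

lemma arrivalProb_nonneg (hf : ∀ x, 0 ≤ f x) {a b σ : ℝ} (hab : a ≤ b) (hσ : 0 < σ) (i : ℤ) :
    0 ≤ arrivalProb lam f a b σ i :=
  intervalIntegral.integral_nonneg hab fun x _ => mul_nonneg (by positivity) (hf _)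

lemma arrivalProb_add (hf : Continuous f) (a b c σ : ℝ) (i : ℤ) :
    arrivalProb lam f a b σ i + arrivalProb lam f b c σ i = arrivalProb lam f a c σ i :=
  intervalIntegral.integral_add_adjacent_intervals
    ((continuous_arrivalDensity hf σ i).intervalIntegrable _ _)
    ((continuous_arrivalDensity hf σ i).intervalIntegrable _ _)

lemma arrivalProb_le {M : ℝ} (hf : Continuous f) (hM : ∀ x, f x ≤ M) {a b σ : ℝ} (hab : a ≤ b)
    (hσ : 0 < σ) (i : ℤ) : arrivalProb lam f a b σ i ≤ (b - a) * M / σ := by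
  have h : arrivalProb lam f a b σ i ≤ ∫ _ in a..b, (1 / σ) * M := by
    refine intervalIntegral.integral_mono_on hab
      ((continuous_arrivalDensity hf σ i).intervalIntegrable _ _) (by simp) fun x _ => ?_
    have := hM ((x - i / lam) / σ)
    gcongr
  refine h.trans_eq ?_
  simp only [intervalIntegral.integral_const, smul_eq_mul]
  ring

lemma hasSum_arrivalProb_period (hlam : 0 < lam) (hf_int : Integrable f) (hf_prob : ∫ x, f x = 1)
    {σ : ℝ} (hσ : 0 < σ) (a : ℝ) : HasSum (arrivalProb lam f a (a + 1 / lam) σ) 1 := by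
  have hc : 0 < lam * σ := by positivity
  have hg : Integrable fun y => (lam * σ)⁻¹ * f (y / (lam * σ)) :=
    (hf_int.comp_div hc.ne').const_mul _
  have h := hg.hasSum_intervalIntegral (lam * a)
  have h1 : ∫ y, (lam * σ)⁻¹ * f (y / (lam * σ)) = 1 := by
    rw [integral_const_mul, Measure.integral_comp_div, hf_prob, abs_of_pos hc]
    rw [smul_eq_mul, mul_one, inv_mul_cancel₀ hc.ne']
  rw [h1, ← (Equiv.neg ℤ).hasSum_iff] at h
  refine (funext fun i => ?_ : arrivalProb lam f a (a + 1 / lam) σ = _) ▸ h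
  simp only [Function.comp_apply, Equiv.neg_apply, Int.cast_neg, arrivalProb]
  have e : ∀ x, (1 / σ) * f ((x - i / lam) / σ) =
      lam * (fun y => (lam * σ)⁻¹ * f (y / (lam * σ))) (lam * x - i) := by
    intro x
    have : (lam * x - i) / (lam * σ) = (x - i / lam) / σ := by field_simp
    simp only [this]
    field_simp
  simp_rw [e]
  rw [intervalIntegral.integral_const_mul]
  refine (intervalIntegral.smul_integral_comp_mul_sub
    (fun y => (lam * σ)⁻¹ * f (y / (lam * σ))) lam (i : ℝ)).trans ?_
  congr 1
  field_simp
  ring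

lemma hasSum_arrivalProb_nat (hlam : 0 < lam) (hf : Continuous f) (hf_int : Integrable f)
    (hf_prob : ∫ x, f x = 1) {σ : ℝ} (hσ : 0 < σ) (a : ℝ) (k : ℕ) :
    HasSum (arrivalProb lam f a (a + k / lam) σ) k := by
  induction k with
  | zero =>
    convert (hasSum_zero : HasSum (fun _ : ℤ => (0 : ℝ)) 0) using 1
    · ext i
      simp [arrivalProb]
    · simp
  | succ k ih =>
    convert ih.add (hasSum_arrivalProb_period hlam hf_int hf_prob hσ (a + k / lam)) using 1
    · ext i
      rw [arrivalProb_add hf]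
      congr 1
      push_cast
      ring
    · push_cast
      rfl

lemma summable_arrivalProb (hlam : 0 < lam) (hf : Continuous f) (hf_nonneg : ∀ x, 0 ≤ f x)
    (hf_int : Integrable f) (hf_prob : ∫ x, f x = 1) {a b σ : ℝ} (hab : a ≤ b) (hσ : 0 < σ) :
    Summable (arrivalProb lam f a b σ) := by
  obtain ⟨k, hk⟩ := exists_nat_ge (lam * (b - a))
  have hb : b ≤ a + k / lam := by
    have : b - a ≤ k / lam := by rw [le_div_iff₀ hlam]; linarith
    linarith
  refine Summable.of_nonneg_of_le (arrivalProb_nonneg hf_nonneg hab hσ) (fun i => ?_)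
    (hasSum_arrivalProb_nat hlam hf hf_int hf_prob hσ a k).summable
  rw [← arrivalProb_add hf a b (a + k / lam)]
  linarith [arrivalProb_nonneg (lam := lam) hf_nonneg hb hσ i]

lemma lintegral_comp_floor_mul {c : ℝ} (hc : 0 < c) (Φ : ℤ → ENNReal) :
    ∫⁻ u : ℝ, Φ ⌊c * u⌋ = ∑' i, Φ i * ENNReal.ofReal c⁻¹ := by
  have hm : Measurable fun u : ℝ => ⌊c * u⌋ := Int.measurable_floor.comp (measurable_const_mul c)
  rw [← lintegral_map (μ := volume) (measurable_from_top (f := Φ)) hm, lintegral_countable']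
  congr 1 with i
  rw [Measure.map_apply hm (measurableSet_singleton i)]
  have : (fun u : ℝ => ⌊c * u⌋) ⁻¹' {i} = Set.Ico (i / c) ((i + 1) / c) := by
    ext u
    simp only [Set.mem_preimage, Set.mem_singleton_iff, Int.floor_eq_iff, Set.mem_Ico,
      div_le_iff₀ hc, lt_div_iff₀ hc, mul_comm u]
  rw [this, Real.volume_Ico]
  congr 2
  field_simp
  ring

lemma tendsto_floor_mul_div (hlam : 0 < lam) (x u : ℝ) :
    Tendsto (fun σ : ℝ => (x - ⌊lam * σ * u⌋ / lam) / σ) atTop (nhds (-u)) := by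
  have h1 : Tendsto (fun σ : ℝ => -u + (x + Int.fract (lam * σ * u) / lam) / σ)
      atTop (nhds (-u + 0)) := by
    refine tendsto_const_nhds.add ?_
    refine squeeze_zero_norm' (a := fun σ => (|x| + 1 / lam) / σ) ?_
      (tendsto_const_nhds.div_atTop tendsto_id)
    filter_upwards [eventually_gt_atTop 0] with σ hσ
    rw [norm_div, Real.norm_eq_abs, Real.norm_eq_abs, abs_of_pos hσ]
    gcongr
    refine (abs_add_le _ _).trans ?_
    gcongr
    rw [abs_of_nonneg (div_nonneg (Int.fract_nonneg _) hlam.le)]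
    gcongr
    exact (Int.fract_lt_one _).le
  rw [add_zero] at h1
  refine h1.congr' ?_
  filter_upwards [eventually_gt_atTop 0] with σ hσ
  rw [Int.fract]
  field_simp
  ring

lemma ofReal_tsum_arrivalProb (hlam : 0 < lam) (hf : Continuous f) (hf_nonneg : ∀ x, 0 ≤ f x)
    (hf_int : Integrable f) (hf_prob : ∫ x, f x = 1) {a b σ : ℝ} (hab : a ≤ b) (hσ : 0 < σ) :
    ENNReal.ofReal (∑' i, arrivalProb lam f a b σ i) =
      ENNReal.ofReal lam * ∫⁻ u : ℝ, ∫⁻ x in Set.Ioc a b,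
        ENNReal.ofReal (f ((x - ⌊lam * σ * u⌋ / lam) / σ)) := by
  have hc : 0 < lam * σ := by positivity
  rw [ENNReal.ofReal_tsum_of_nonneg (arrivalProb_nonneg hf_nonneg hab hσ)
    (summable_arrivalProb hlam hf hf_nonneg hf_int hf_prob hab hσ),
    lintegral_comp_floor_mul hc fun i => ∫⁻ x in Set.Ioc a b,
      ENNReal.ofReal (f ((x - i / lam) / σ)), ← ENNReal.tsum_mul_left]
  congr 1 with i
  have hint := ((continuous_arrivalDensity (lam := lam) hf σ i).intervalIntegrable
    (μ := volume) a b).1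
  rw [arrivalProb, intervalIntegral.integral_of_le hab, ofReal_integral_eq_lintegral_ofReal hint
    (ae_of_all _ fun x => mul_nonneg (by positivity) (hf_nonneg _))]
  simp_rw [ENNReal.ofReal_mul (show 0 ≤ 1 / σ by positivity)]
  rw [lintegral_const_mul' _ _ ENNReal.ofReal_ne_top, mul_comm (∫⁻ _ in _, _), ← mul_assoc,
    ← ENNReal.ofReal_mul hlam.le]
  congr 2
  field_simp

lemma ofReal_le_liminf_tsum_arrivalProb (hlam : 0 < lam) (hf : Continuous f)
    (hf_nonneg : ∀ x, 0 ≤ f x) (hf_int : Integrable f) (hf_prob : ∫ x, f x = 1) {a b : ℝ}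
    (hab : a ≤ b) :
    ENNReal.ofReal (lam * (b - a)) ≤
      liminf (fun σ => ENNReal.ofReal (∑' i, arrivalProb lam f a b σ i)) atTop := by
  have hF : Continuous fun x => ENNReal.ofReal (f x) := ENNReal.continuous_ofReal.comp hf
  have hinner : ∀ u : ℝ, ENNReal.ofReal (b - a) * ENNReal.ofReal (f (-u)) ≤
      liminf (fun σ : ℝ => ∫⁻ x in Set.Ioc a b,
        ENNReal.ofReal (f ((x - ⌊lam * σ * u⌋ / lam) / σ))) atTop := by
    intro u
    refine le_trans (le_of_eq ?_) (lintegral_liminf_le fun σ => ?_)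
    · have : ∀ x : ℝ, liminf (fun σ : ℝ =>
          ENNReal.ofReal (f ((x - ⌊lam * σ * u⌋ / lam) / σ))) atTop = ENNReal.ofReal (f (-u)) :=
        fun x => ((hF.tendsto _).comp (tendsto_floor_mul_div hlam x u)).liminf_eq
      simp_rw [this]
      simp [mul_comm]
    · exact hF.measurable.comp (by fun_prop)
  have hmass : ∫⁻ u, ENNReal.ofReal (f (-u)) = 1 := by
    rw [← ofReal_integral_eq_lintegral_ofReal hf_int.comp_neg (ae_of_all _ fun x => hf_nonneg _),
      integral_neg_eq_self f, hf_prob, ENNReal.ofReal_one]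
  have hfatou : ENNReal.ofReal (b - a) ≤ liminf (fun σ : ℝ => ∫⁻ u : ℝ, ∫⁻ x in Set.Ioc a b,
      ENNReal.ofReal (f ((x - ⌊lam * σ * u⌋ / lam) / σ))) atTop := by
    calc ENNReal.ofReal (b - a)
        = ∫⁻ u, ENNReal.ofReal (b - a) * ENNReal.ofReal (f (-u)) := by
          rw [lintegral_const_mul' _ _ ENNReal.ofReal_ne_top, hmass, mul_one]
      _ ≤ _ := lintegral_mono hinner
      _ ≤ _ := lintegral_liminf_le fun σ =>
          (measurable_from_top (f := fun i : ℤ => ∫⁻ x in Set.Ioc a b,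
            ENNReal.ofReal (f ((x - i / lam) / σ)))).comp
            (Int.measurable_floor.comp (measurable_const_mul (lam * σ)))
  have hev : (fun σ => ENNReal.ofReal (∑' i, arrivalProb lam f a b σ i)) =ᶠ[atTop]
      fun σ => ENNReal.ofReal lam * ∫⁻ u : ℝ, ∫⁻ x in Set.Ioc a b,
        ENNReal.ofReal (f ((x - ⌊lam * σ * u⌋ / lam) / σ)) := by
    filter_upwards [eventually_gt_atTop 0] with σ hσ
    exact ofReal_tsum_arrivalProb hlam hf hf_nonneg hf_int hf_prob hab hσ
  rw [liminf_congr hev, ENNReal.liminf_const_mul_of_ne_top ENNReal.ofReal_ne_top,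
    ENNReal.ofReal_mul hlam.le]
  gcongr

lemma eventually_lt_tsum_arrivalProb (hlam : 0 < lam) (hf : Continuous f)
    (hf_nonneg : ∀ x, 0 ≤ f x) (hf_int : Integrable f) (hf_prob : ∫ x, f x = 1) {a b r : ℝ}
    (hab : a < b) (hr : r < lam * (b - a)) :
    ∀ᶠ σ in atTop, r < ∑' i, arrivalProb lam f a b σ i := by
  have hpos : 0 < lam * (b - a) := mul_pos hlam (sub_pos.2 hab)
  have h := eventually_lt_of_lt_liminf (((ENNReal.ofReal_lt_ofReal_iff hpos).2 hr).trans_le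
    (ofReal_le_liminf_tsum_arrivalProb hlam hf hf_nonneg hf_int hf_prob hab.le))
  filter_upwards [h] with σ hσ
  exact (ENNReal.ofReal_lt_ofReal_iff'.1 hσ).1

/-- The expected number of arrivals in `(a, b]` converges to `λ (b - a)`. -/
lemma tendsto_tsum_arrivalProb (hlam : 0 < lam) (hf : Continuous f)
    (hf_nonneg : ∀ x, 0 ≤ f x) (hf_int : Integrable f) (hf_prob : ∫ x, f x = 1) {a b : ℝ}
    (hab : a < b) :
    Tendsto (fun σ => ∑' i, arrivalProb lam f a b σ i) atTop (nhds (lam * (b - a))) := by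
  obtain ⟨k, hk⟩ := exists_nat_gt (lam * (b - a))
  have hb : b < a + k / lam := by
    have : b - a < k / lam := by rw [lt_div_iff₀ hlam]; linarith
    linarith
  refine tendsto_order.2 ⟨fun r hr =>
    eventually_lt_tsum_arrivalProb hlam hf hf_nonneg hf_int hf_prob hab hr, fun r hr => ?_⟩
  have hr' : k - r < lam * (a + k / lam - b) := by
    have : lam * (a + k / lam - b) = k - lam * (b - a) := by field_simp; ring
    linarith
  filter_upwards [eventually_lt_tsum_arrivalProb hlam hf hf_nonneg hf_int hf_prob hb hr',
    eventually_gt_atTop 0] with σ h hσ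
  have hsum := (hasSum_arrivalProb_nat hlam hf hf_int hf_prob hσ a k).tsum_eq
  simp_rw [← arrivalProb_add (lam := lam) hf a b (a + k / lam)] at hsum
  rw [(summable_arrivalProb hlam hf hf_nonneg hf_int hf_prob hab.le hσ).tsum_add
    (summable_arrivalProb hlam hf hf_nonneg hf_int hf_prob hb.le hσ)] at hsum
  linarith

end ArrivalProb

/-- Poisson limit theorem for the products `∏ (1 + w p_i)` over a null array of nonnegative
reals. -/
lemma tendsto_tprod_one_add_mul {α ι : Type*} {l : Filter α} {p : α → ι → ℝ} {δ : α → ℝ} {m : ℝ}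
    (w : ℂ) (hp : ∀ᶠ s in l, ∀ i, 0 ≤ p s i) (hδ : ∀ᶠ s in l, ∀ i, p s i ≤ δ s)
    (hδ0 : Tendsto δ l (nhds 0)) (hsum : ∀ᶠ s in l, Summable (p s))
    (hm : Tendsto (fun s => ∑' i, p s i) l (nhds m)) :
    Tendsto (fun s => ∏' i, (1 + w * (p s i : ℂ))) l (nhds (Complex.exp (m * w))) := by
  have hsmall : ∀ᶠ s in l, ‖w‖ * δ s < 1 / 2 := by
    have : Tendsto (fun s => ‖w‖ * δ s) l (nhds 0) := by simpa using hδ0.const_mul ‖w‖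
    exact this.eventually_lt_const (by norm_num)
  have hbound : ∀ᶠ s in l, ∀ i, ‖w * (p s i : ℂ)‖ < 1 / 2 := by
    filter_upwards [hp, hδ, hsmall] with s h0 h1 h2 i
    rw [norm_mul, Complex.norm_real, Real.norm_of_nonneg (h0 i)]
    exact (mul_le_mul_of_nonneg_left (h1 i) (norm_nonneg w)).trans_lt h2
  have hcsum : ∀ᶠ s in l, Summable fun i => w * (p s i : ℂ) := by
    filter_upwards [hsum] with s h
    exact (Complex.summable_ofReal.2 h).mul_left w
  have herr : Tendsto (fun s => ∑' i, Complex.log (1 + w * (p s i : ℂ)) - ∑' i, w * (p s i : ℂ))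
      l (nhds 0) := by
    refine squeeze_zero_norm' (a := fun s => ‖w‖ ^ 2 * δ s * ∑' i, p s i) ?_ ?_
    · filter_upwards [hp, hδ, hbound, hcsum, hsum] with s h0 h1 h2 h3 h4
      rw [← (Complex.summable_log_one_add_of_summable h3).tsum_sub h3]
      refine tsum_of_norm_bounded (h4.hasSum.mul_left (‖w‖ ^ 2 * δ s)) fun i => ?_
      refine (Complex.norm_log_one_add_sub_self_le ((h2 i).trans (by norm_num))).trans ?_
      have hinv : (1 - ‖w * (p s i : ℂ)‖)⁻¹ ≤ 2 := by
        rw [inv_le_comm₀ (by linarith [h2 i]) two_pos]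
        linarith [h2 i]
      calc ‖w * (p s i : ℂ)‖ ^ 2 * (1 - ‖w * (p s i : ℂ)‖)⁻¹ / 2
          ≤ ‖w * (p s i : ℂ)‖ ^ 2 * 2 / 2 := by gcongr
        _ = ‖w‖ ^ 2 * p s i * p s i := by
          rw [norm_mul, Complex.norm_real, Real.norm_of_nonneg (h0 i)]
          ring
        _ ≤ ‖w‖ ^ 2 * δ s * p s i := by
          have := h0 i
          have := h1 i
          gcongr
    · simpa using (hδ0.const_mul (‖w‖ ^ 2)).mul hm
  have hmain : Tendsto (fun s => ∑' i, w * (p s i : ℂ)) l (nhds (m * w)) := by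
    have : Tendsto (fun s => ((∑' i, p s i : ℝ) : ℂ) * w) l (nhds (m * w)) :=
      ((Complex.continuous_ofReal.tendsto m).comp hm).mul_const w
    refine this.congr fun s => ?_
    rw [Complex.ofReal_tsum, tsum_mul_left, mul_comm]
  have hlog := herr.add hmain
  simp only [sub_add_cancel, zero_add] at hlog
  refine ((Complex.continuous_exp.tendsto _).comp hlog).congr' ?_
  filter_upwards [hbound, hcsum] with s h2 h3
  refine Complex.cexp_tsum_eq_tprod (fun i h => ?_) (Complex.summable_log_one_add_of_summable h3)
  have h4 := h2 i
  rw [← eq_neg_of_add_eq_zero_right h |>.symm, norm_neg, norm_one] at h4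
  norm_num at h4

/-- For every `t ∈ ℝ`, `T > 0` and complex `z` with `|z| ≤ 1`, the generating
function `q^{(σ)}(z) = Π_{i∈ℤ} (1 + (z-1)·p_i(t,t+T))` of the number of PSRA arrivals in
`(t,t+T]` converges, as `σ → ∞`, to `exp(λT(z-1))`, the generating function of the Poisson
distribution with intensity `λT`. -/
theorem psra_generating_function_tendsto_poisson (lam M : ℝ) (hlam : 0 < lam)
    (f : ℝ → ℝ) (hf_cont : Continuous f) (hf_nonneg : ∀ x, 0 ≤ f x)
    (hf_int : Integrable f) (hf_prob : ∫ x, f x = 1)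
    (hf_bdd : ∀ x, f x ≤ M)
    (hf_var : Integrable (fun x => x ^ 2 * f x))
    (t T : ℝ) (hT : 0 < T) (z : ℂ) (hz : ‖z‖ ≤ 1)
    (p : ℝ → ℤ → ℝ)
    (hp : ∀ σ i, p σ i = ∫ x in t..(t + T), (1 / σ) * f ((x - i / lam) / σ)) :
    Tendsto (fun σ : ℝ => ∏' i : ℤ, (1 + (z - 1) * (p σ i : ℂ)))
      atTop (nhds (Complex.exp ((lam * T : ℝ) * (z - 1)))) := by
  obtain rfl : p = arrivalProb lam f t (t + T) := by
    ext σ i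
    exact hp σ i
  have htT : t < t + T := by linarith
  have hm := tendsto_tsum_arrivalProb hlam hf_cont hf_nonneg hf_int hf_prob htT
  rw [add_sub_cancel_left] at hm
  refine tendsto_tprod_one_add_mul (δ := fun σ => (t + T - t) * M / σ) (z - 1) ?_ ?_
    (tendsto_const_nhds.div_atTop tendsto_id) ?_ hm
  · filter_upwards [eventually_gt_atTop 0] with σ hσ
    exact arrivalProb_nonneg hf_nonneg htT.le hσ
  · filter_upwards [eventually_gt_atTop 0] with σ hσ
    exact arrivalProb_le hf_cont hf_bdd htT.le hσ
  · filter_upwards [eventually_gt_atTop 0] with σ hσ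
    exact summable_arrivalProb hlam hf_cont hf_nonneg hf_int hf_prob htT.le hσ
end

section
/- Fix γ ∈ (0,1]. Let q_{γ,n}^{(σ)} be the distribution of the number of arrivals in (t,t+T] of the PSRA process with independent deletion probability 1-γ, and let q_{γ,n} = e^{-γλT}(γλT)^n/n! be the Poisson distribution with intensity γλT. Then Σ_{n=0}^∞ |q_{γ,n}^{(σ)} - q_{γ,n}| → 0 as σ → ∞. -/
open MeasureTheory ProbabilityTheory Filter

open scoped ENNReal Topology

section EventCount

variable {Ω ι : Type*}

/-- The number of events `A i` that occur at a sample point. -/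
noncomputable def eventCount (A : ι → Set Ω) (ω : Ω) : ℝ≥0∞ :=
  ∑' i, (A i).indicator 1 ω

open Classical in
/-- The number of events `A j`, `j ≠ i`, that occur at a sample point. -/
noncomputable def eventCountExcept (A : ι → Set Ω) (i : ι) (ω : Ω) : ℝ≥0∞ :=
  ∑' j, if j = i then 0 else (A j).indicator 1 ω

lemma eventCount_eq_add_eventCountExcept (A : ι → Set Ω) (i : ι) (ω : Ω) :
    eventCount A ω = (A i).indicator 1 ω + eventCountExcept A i ω :=
  ENNReal.tsum_eq_add_tsum_ite i

lemma inter_eventCount_succ (A : ι → Set Ω) (i : ι) (n : ℕ) :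
    A i ∩ {ω | eventCount A ω = (n + 1 : ℕ)} = A i ∩ {ω | eventCountExcept A i ω = n} := by
  ext ω
  refine and_congr_right fun h ↦ ?_
  simp only [Set.mem_ofPred_eq, eventCount_eq_add_eventCountExcept A i, Set.indicator_of_mem h,
    Pi.one_apply, Nat.cast_add, Nat.cast_one, add_comm (1 : ℝ≥0∞)]
  exact ENNReal.add_left_inj ENNReal.one_ne_top

lemma inter_compl_eventCountExcept (A : ι → Set Ω) (i : ι) (n : ℕ) :
    {ω | eventCountExcept A i ω = n} ∩ (A i)ᶜ = {ω | eventCount A ω = n} ∩ (A i)ᶜ := by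
  ext ω
  refine and_congr_left fun h ↦ ?_
  simp [eventCount_eq_add_eventCountExcept A i, Set.indicator_of_notMem h]

lemma eventCount_zero (A : ι → Set Ω) : {ω | eventCount A ω = (0 : ℕ)} = ⋂ i, (A i)ᶜ := by
  ext ω
  simp [eventCount, ENNReal.tsum_eq_zero]

lemma tsum_indicator_eq_iff_eventCount (A : ι → Set Ω) (ω : Ω) (n : ℕ) :
    ∑' i, (A i).indicator (fun _ ↦ (1 : ℕ∞)) ω = n ↔ eventCount A ω = n := by
  have hs : HasSum (fun i ↦ (A i).indicator (fun _ ↦ (1 : ℕ∞)) ω)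
      (∑' i, (A i).indicator (fun _ ↦ (1 : ℕ∞)) ω) :=
    (hasSum_of_isLUB _ (isLUB_sSup _)).summable.hasSum
  have h := (hs.map ENat.toENNRealRingHom ENat.continuous_toENNReal).tsum_eq
  have h2 : eventCount A ω = ENat.toENNRealRingHom
      (∑' i, (A i).indicator (fun _ ↦ (1 : ℕ∞)) ω) := by
    rw [← h, eventCount]
    refine tsum_congr fun i ↦ ?_
    by_cases hi : ω ∈ A i <;> simp [hi]
  rw [h2]
  change _ ↔ ENat.toENNReal _ = _
  rw [← ENat.toENNReal_coe, ENat.toENNReal_inj]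

lemma pairwise_disjoint_eventCount (A : ι → Set Ω) :
    Pairwise (Function.onFun Disjoint fun n : ℕ ↦ {ω | eventCount A ω = n}) := fun n k hnk ↦ by
  refine Set.disjoint_left.2 fun ω hn hk ↦ hnk ?_
  exact_mod_cast (show (n : ℝ≥0∞) = k from hn.symm.trans hk)

lemma measurableSet_generateFrom_eventCountExcept [Countable ι] (A : ι → Set Ω) (i : ι) (n : ℕ) :
    MeasurableSet[MeasurableSpace.generateFrom {t | ∃ k ∈ ({i}ᶜ : Set ι), A k = t}]
      {ω | eventCountExcept A i ω = n} := by
  let _ := MeasurableSpace.generateFrom {t | ∃ k ∈ ({i}ᶜ : Set ι), A k = t}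
  have h : Measurable (eventCountExcept A i) := by
    refine Measurable.tsum fun j ↦ ?_
    by_cases hj : j = i
    · simp [hj]
    · simp only [hj, if_false]
      exact measurable_one.indicator (MeasurableSpace.measurableSet_generateFrom ⟨j, hj, rfl⟩)
  exact h (measurableSet_singleton _)

variable [MeasurableSpace Ω] {A : ι → Set Ω}

lemma abs_measureReal_eventCountExcept_sub_le {μ : Measure Ω} [IsFiniteMeasure μ]
    (hA : ∀ i, MeasurableSet (A i)) (i : ι) (n : ℕ) :
    |μ.real {ω | eventCountExcept A i ω = n} - μ.real {ω | eventCount A ω = n}| ≤ μ.real (A i) := by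
  have h (S : Set Ω) : μ.real (S ∩ A i) + μ.real (S ∩ (A i)ᶜ) = μ.real S := by
    rw [← Set.sdiff_eq, measureReal_inter_add_sdiff (hA i)]
  have h1 := h {ω | eventCountExcept A i ω = n}
  have h2 := h {ω | eventCount A ω = n}
  rw [inter_compl_eventCountExcept] at h1
  have h3 : μ.real ({ω | eventCountExcept A i ω = n} ∩ A i) ≤ μ.real (A i) :=
    measureReal_mono Set.inter_subset_right
  have h4 : μ.real ({ω | eventCount A ω = n} ∩ A i) ≤ μ.real (A i) :=
    measureReal_mono Set.inter_subset_right
  rw [abs_le]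
  constructor <;> linarith [
    measureReal_nonneg (μ := μ) (s := {ω | eventCountExcept A i ω = n} ∩ A i),
    measureReal_nonneg (μ := μ) (s := {ω | eventCount A ω = n} ∩ A i)]

variable [Countable ι]

lemma measurable_eventCount (hA : ∀ i, MeasurableSet (A i)) : Measurable (eventCount A) :=
  Measurable.tsum fun i ↦ measurable_one.indicator (hA i)

lemma measurableSet_eventCount (hA : ∀ i, MeasurableSet (A i)) (n : ℕ) :
    MeasurableSet {ω | eventCount A ω = n} :=
  measurable_eventCount hA (measurableSet_singleton _)

lemma tsum_measure_inter_eventCount (μ : Measure Ω) (hA : ∀ i, MeasurableSet (A i)) (n : ℕ) :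
    ∑' i, μ (A i ∩ {ω | eventCount A ω = n}) = n * μ {ω | eventCount A ω = n} := by
  have hE := measurableSet_eventCount hA n
  calc ∑' i, μ (A i ∩ {ω | eventCount A ω = n})
      = ∑' i, ∫⁻ ω in {ω | eventCount A ω = n}, (A i).indicator 1 ω ∂μ := by
        refine tsum_congr fun i ↦ ?_
        rw [lintegral_indicator_one (hA i), Measure.restrict_apply (hA i)]
    _ = ∫⁻ ω in {ω | eventCount A ω = n}, eventCount A ω ∂μ :=
        (lintegral_tsum fun i ↦ (measurable_one.indicator (hA i)).aemeasurable).symm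
    _ = ∫⁻ ω in {ω | eventCount A ω = n}, n ∂μ := setLIntegral_congr_fun hE fun ω hω ↦ hω
    _ = n * μ {ω | eventCount A ω = n} := by simp

variable {μ : Measure Ω}

lemma measureReal_inter_eventCount_succ (hA : ∀ i, MeasurableSet (A i)) (hind : iIndepSet A μ)
    (i : ι) (n : ℕ) :
    μ.real (A i ∩ {ω | eventCount A ω = (n + 1 : ℕ)}) =
      μ.real (A i) * μ.real {ω | eventCountExcept A i ω = n} := by
  have h := (Indep_iff _ _ μ).1 (hind.indep_generateFrom_of_disjoint hA {i} {i}ᶜ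
    disjoint_compl_right) (A i) _ (MeasurableSpace.measurableSet_generateFrom ⟨i, rfl, rfl⟩)
    (measurableSet_generateFrom_eventCountExcept A i n)
  rw [inter_eventCount_succ, measureReal_def, h, ENNReal.toReal_mul, measureReal_def,
    measureReal_def]

variable [IsProbabilityMeasure μ]

lemma hasSum_measureReal_inter_eventCount (hA : ∀ i, MeasurableSet (A i)) (n : ℕ) :
    HasSum (fun i ↦ μ.real (A i ∩ {ω | eventCount A ω = n}))
      (n * μ.real {ω | eventCount A ω = n}) := by
  have h := tsum_measure_inter_eventCount μ hA n
  have hne : ∑' i, μ (A i ∩ {ω | eventCount A ω = n}) ≠ ∞ := by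
    rw [h]; exact ENNReal.mul_ne_top (ENNReal.natCast_ne_top n) (measure_ne_top _ _)
  have h2 := ENNReal.hasSum_toReal hne
  rw [← ENNReal.tsum_toReal_eq (ENNReal.ne_top_of_tsum_ne_top hne), h, ENNReal.toReal_mul] at h2
  simpa only [ENNReal.toReal_natCast, measureReal_def] using h2

lemma abs_succ_mul_measureReal_eventCount_sub_le (hA : ∀ i, MeasurableSet (A i))
    (hind : iIndepSet A μ) {L m : ℝ} (hL : HasSum (fun i ↦ μ.real (A i)) L)
    (hm : ∀ i, μ.real (A i) ≤ m) (n : ℕ) :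
    |(n + 1) * μ.real {ω | eventCount A ω = (n + 1 : ℕ)} - L * μ.real {ω | eventCount A ω = n}|
      ≤ m * L := by
  have h1 := hasSum_measureReal_inter_eventCount (μ := μ) hA (n + 1)
  simp only [measureReal_inter_eventCount_succ hA hind] at h1
  have h2 := h1.sub (hL.mul_right (μ.real {ω | eventCount A ω = n}))
  simp only [← mul_sub] at h2
  have h3 (i : ι) := abs_measureReal_eventCountExcept_sub_le (μ := μ) hA i n
  have h4 : ∀ i, |μ.real (A i) * (μ.real {ω | eventCountExcept A i ω = n} -
      μ.real {ω | eventCount A ω = n})| ≤ m * μ.real (A i) := fun i ↦ by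
    rw [abs_mul, abs_of_nonneg measureReal_nonneg, mul_comm m]
    exact mul_le_mul_of_nonneg_left ((h3 i).trans (hm i)) measureReal_nonneg
  rw [Nat.cast_succ] at h2
  rw [abs_le]
  exact ⟨neg_le_of_neg_le (hasSum_le (fun i ↦ neg_le.1 (neg_le_of_abs_le (h4 i)))
    h2.neg (hL.mul_left m)),
    hasSum_le (fun i ↦ le_of_abs_le (h4 i)) h2 (hL.mul_left m)⟩

lemma tendsto_prod_one_sub_eventCount_zero (hA : ∀ i, MeasurableSet (A i))
    (hind : iIndepSet A μ) :
    Tendsto (fun s : Finset ι ↦ ∏ i ∈ s, (1 - μ.real (A i))) atTop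
      (𝓝 (μ.real {ω | eventCount A ω = (0 : ℕ)})) := by
  have h1 : Tendsto (fun s : Finset ι ↦ μ (⋂ i ∈ s, (A i)ᶜ)) atTop
      (𝓝 (μ (⋂ s : Finset ι, ⋂ i ∈ s, (A i)ᶜ))) := by
    refine tendsto_measure_iInter_atTop (fun s ↦ ?_) (fun s t hst ↦ ?_) ⟨∅, measure_ne_top _ _⟩
    · exact (Finset.measurableSet_biInter _ fun i _ ↦ (hA i).compl).nullMeasurableSet
    · exact Set.biInter_subset_biInter_left hst
  have h2 : ⋂ s : Finset ι, ⋂ i ∈ s, (A i)ᶜ = ⋂ i, (A i)ᶜ := by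
    ext ω
    simp only [Set.mem_iInter]
    exact ⟨fun h i ↦ h {i} i (by simp), fun h s i _ ↦ h i⟩
  rw [eventCount_zero, ← h2]
  refine ((ENNReal.tendsto_toReal (measure_ne_top _ _)).comp h1).congr fun s ↦ ?_
  rw [Function.comp, iIndep.meas_biInter hind (fun i _ ↦
    (MeasurableSpace.measurableSet_generateFrom (Set.mem_singleton _)).compl), ENNReal.toReal_prod]
  exact Finset.prod_congr rfl fun i _ ↦ probReal_compl_eq_one_sub (hA i)

lemma measureReal_eventCount_zero_le (hA : ∀ i, MeasurableSet (A i))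
    (hind : iIndepSet A μ) {L : ℝ} (hL : HasSum (fun i ↦ μ.real (A i)) L) :
    μ.real {ω | eventCount A ω = (0 : ℕ)} ≤ Real.exp (-L) := by
  refine le_of_tendsto_of_tendsto' (tendsto_prod_one_sub_eventCount_zero hA hind)
    ((Real.continuous_exp.tendsto _).comp (Tendsto.neg hL)) fun s ↦ ?_
  simp only [Function.comp, ← Finset.sum_neg_distrib, Real.exp_sum]
  exact Finset.prod_le_prod (fun i _ ↦ sub_nonneg.2 measureReal_le_one)
    fun i _ ↦ Real.one_sub_le_exp_neg _

lemma exp_le_measureReal_eventCount_zero (hA : ∀ i, MeasurableSet (A i))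
    (hind : iIndepSet A μ) {L m : ℝ} (hL : HasSum (fun i ↦ μ.real (A i)) L)
    (hm : ∀ i, μ.real (A i) ≤ m) (hm1 : m < 1) :
    Real.exp (-(L / (1 - m))) ≤ μ.real {ω | eventCount A ω = (0 : ℕ)} := by
  refine le_of_tendsto_of_tendsto'
    ((Real.continuous_exp.tendsto _).comp (Tendsto.neg (hL.div_const (1 - m))))
    (tendsto_prod_one_sub_eventCount_zero hA hind) fun s ↦ ?_
  simp only [Function.comp, ← Finset.sum_neg_distrib, Real.exp_sum]
  refine Finset.prod_le_prod (fun i _ ↦ (Real.exp_pos _).le) fun i _ ↦ ?_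
  set p := μ.real (A i)
  have hp : 0 < 1 - p := by linarith [hm i]
  have h1 : p / (1 - p) ≤ p / (1 - m) :=
    div_le_div_of_nonneg_left measureReal_nonneg (by linarith) (by linarith [hm i])
  calc Real.exp (-(p / (1 - m))) ≤ Real.exp (-(p / (1 - p))) := Real.exp_le_exp.2 (by linarith)
    _ = (Real.exp (p / (1 - p)))⁻¹ := Real.exp_neg _
    _ ≤ ((1 - p)⁻¹)⁻¹ := by
        refine inv_anti₀ (inv_pos.2 hp) ?_
        have h2 := Real.add_one_le_exp (p / (1 - p))
        have h3 : p / (1 - p) + 1 = (1 - p)⁻¹ := by field_simp; ring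
        linarith
    _ = 1 - p := inv_inv _

end EventCount

section PoissonLimit

variable {Ω ι α : Type*} [MeasurableSpace Ω] [Countable ι]

/-- **Poisson limit theorem** for infinite families of independent rare events. -/
theorem tendsto_measureReal_eventCount {l : Filter α} {μ : α → Measure Ω}
    [∀ a, IsProbabilityMeasure (μ a)] {A : α → ι → Set Ω} {L m : α → ℝ} {r : ℝ}
    (hA : ∀ a i, MeasurableSet (A a i)) (hind : ∀ᶠ a in l, iIndepSet (A a) (μ a))
    (hL : ∀ᶠ a in l, HasSum (fun i ↦ (μ a).real (A a i)) (L a))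
    (hm : ∀ᶠ a in l, ∀ i, (μ a).real (A a i) ≤ m a)
    (hLr : Tendsto L l (𝓝 r)) (hm0 : Tendsto m l (𝓝 0)) (n : ℕ) :
    Tendsto (fun a ↦ (μ a).real {ω | eventCount (A a) ω = n}) l
      (𝓝 (Real.exp (-r) * r ^ n / n.factorial)) := by
  induction n with
  | zero =>
    have hlow : Tendsto (fun a ↦ Real.exp (-(L a / (1 - m a)))) l (𝓝 (Real.exp (-r))) := by
      have h := (Real.continuous_exp.tendsto _).comp
        (hLr.div (tendsto_const_nhds.sub hm0) (by norm_num : (1 : ℝ) - 0 ≠ 0)).neg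
      simpa [Function.comp_def] using h
    have hup : Tendsto (fun a ↦ Real.exp (-L a)) l (𝓝 (Real.exp (-r))) :=
      (Real.continuous_exp.tendsto _).comp hLr.neg
    have key : Tendsto (fun a ↦ (μ a).real {ω | eventCount (A a) ω = (0 : ℕ)}) l
        (𝓝 (Real.exp (-r))) := by
      refine tendsto_of_tendsto_of_tendsto_of_le_of_le' hlow hup ?_ ?_
      · filter_upwards [hind, hL, hm, hm0.eventually_lt_const one_pos] with a h1 h2 h3 h4
        exact exp_le_measureReal_eventCount_zero (hA a) h1 h2 h3 h4
      · filter_upwards [hind, hL] with a h1 h2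
        exact measureReal_eventCount_zero_le (hA a) h1 h2
    simpa using key
  | succ n ih =>
    have hdiff : Tendsto (fun a ↦ (n + 1) * (μ a).real {ω | eventCount (A a) ω = (n + 1 : ℕ)} -
        L a * (μ a).real {ω | eventCount (A a) ω = n}) l (𝓝 0) := by
      refine squeeze_zero_norm' (a := fun a ↦ m a * L a) ?_ (by simpa using hm0.mul hLr)
      filter_upwards [hind, hL, hm] with a h1 h2 h3
      exact abs_succ_mul_measureReal_eventCount_sub_le (hA a) h1 h2 h3 n
    have hn : (n + 1 : ℝ) ≠ 0 := by positivity
    have h := (hdiff.add (hLr.mul ih)).div_const (n + 1 : ℝ)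
    have hlim : (0 + r * (Real.exp (-r) * r ^ n / n.factorial)) / (n + 1 : ℝ) =
        Real.exp (-r) * r ^ (n + 1) / (n + 1).factorial := by
      rw [Nat.factorial_succ]
      push_cast
      field_simp
      ring
    rw [hlim] at h
    refine h.congr fun a ↦ ?_
    field_simp
    ring

/-- **Scheffé's lemma** for sub-probability weights on `ℕ`. -/
theorem tendsto_tsum_abs_sub_of_tendsto {l : Filter α} {q : α → ℕ → ℝ} {p : ℕ → ℝ}
    (hq0 : ∀ a n, 0 ≤ q a n) (hq : ∀ a, Summable (q a)) (hq1 : ∀ a, ∑' n, q a n ≤ 1)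
    (hp0 : ∀ n, 0 ≤ p n) (hp : HasSum p 1) (h : ∀ n, Tendsto (fun a ↦ q a n) l (𝓝 (p n))) :
    Tendsto (fun a ↦ ∑' n, |q a n - p n|) l (𝓝 0) := by
  have hpos : ∀ a n, ‖max (p n - q a n) 0‖ ≤ p n := fun a n ↦ by
    rw [Real.norm_of_nonneg (le_max_right _ _)]
    exact max_le (by linarith [hq0 a n]) (hp0 n)
  have hterm : ∀ n, Tendsto (fun a ↦ max (p n - q a n) 0) l (𝓝 0) := fun n ↦ by
    simpa using ((tendsto_const_nhds (x := p n)).sub (h n)).max (tendsto_const_nhds (x := (0 : ℝ)))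
  have hlim : Tendsto (fun a ↦ 2 * ∑' n, max (p n - q a n) 0) l (𝓝 0) := by
    have h1 := tendsto_tsum_of_dominated_convergence (𝓕 := l) (g := fun _ ↦ (0 : ℝ))
      hp.summable hterm (Eventually.of_forall hpos)
    simpa using h1.const_mul 2
  refine squeeze_zero (fun a ↦ tsum_nonneg fun n ↦ abs_nonneg _) (fun a ↦ ?_) hlim
  have hs : Summable fun n ↦ max (p n - q a n) 0 := .of_norm_bounded hp.summable (hpos a)
  have h2 := ((hs.hasSum.mul_left 2).add (hq a).hasSum).sub hp
  have h3 : (fun n ↦ |q a n - p n|) = fun n ↦ 2 * max (p n - q a n) 0 + q a n - p n := by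
    ext n
    rcases le_total (p n) (q a n) with h | h
    · rw [abs_of_nonneg (by linarith), max_eq_right (by linarith)]; ring
    · rw [abs_of_nonpos (by linarith), max_eq_left (by linarith)]; ring
  rw [h3, h2.tsum_eq]
  linarith [hq1 a]

/-- The Poisson limit theorem in total variation. -/
theorem tendsto_tsum_abs_measureReal_eventCount_sub {l : Filter α} {μ : α → Measure Ω}
    [∀ a, IsProbabilityMeasure (μ a)] {A : α → ι → Set Ω} {L m : α → ℝ} {r : ℝ} (hr : 0 ≤ r)
    (hA : ∀ a i, MeasurableSet (A a i)) (hind : ∀ᶠ a in l, iIndepSet (A a) (μ a))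
    (hL : ∀ᶠ a in l, HasSum (fun i ↦ (μ a).real (A a i)) (L a))
    (hm : ∀ᶠ a in l, ∀ i, (μ a).real (A a i) ≤ m a)
    (hLr : Tendsto L l (𝓝 r)) (hm0 : Tendsto m l (𝓝 0)) :
    Tendsto (fun a ↦ ∑' n : ℕ, |(μ a).real {ω | eventCount (A a) ω = n} -
      Real.exp (-r) * r ^ n / n.factorial|) l (𝓝 0) := by
  have hmeas a n := measurableSet_eventCount (hA a) n
  have hsum a := summable_measure_toReal (μ := μ a) (hmeas a) (pairwise_disjoint_eventCount (A a))
  refine tendsto_tsum_abs_sub_of_tendsto (fun a n ↦ measureReal_nonneg) hsum (fun a ↦ ?_)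
    (fun n ↦ by positivity) ?_ (tendsto_measureReal_eventCount hA hind hL hm hLr hm0)
  · exact (hsum a).tsum_le_of_sum_le fun s ↦ by
      rw [← measureReal_biUnion_finset ((pairwise_disjoint_eventCount (A a)).set_pairwise _)
        (fun n _ ↦ hmeas a n)]
      exact measureReal_le_one
  · have h := (NormedSpace.expSeries_div_hasSum_exp r).mul_left (Real.exp (-r))
    rw [← Real.exp_eq_exp_ℝ, ← Real.exp_add, neg_add_cancel, Real.exp_zero] at h
    simpa only [mul_div_assoc] using h

end PoissonLimit

section Periodization

/-- Translation is continuous in `L¹(ℝ)`. -/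
lemma MeasureTheory.Integrable.tendsto_integral_abs_translate_sub {f : ℝ → ℝ}
    (hf : Integrable f) :
    Tendsto (fun u ↦ ∫ x, |f (x + u) - f x|) (𝓝 0) (𝓝 0) := by
  have : Fact ((1 : ℝ≥0∞) ≠ ∞) := ⟨ENNReal.one_ne_top⟩
  have hc : Continuous fun u : ℝ ↦ DomAddAct.mk u +ᵥ hf.toL1 f :=
    (continuous_id.vadd continuous_const).comp (DomAddAct.continuous_mk)
  have h := ((hc.sub continuous_const).norm (E := Lp ℝ 1 volume)).tendsto' 0 0
    (f := fun u : ℝ ↦ ‖(DomAddAct.mk u +ᵥ hf.toL1 f) - hf.toL1 f‖) (by simp)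
  refine h.congr fun u ↦ ?_
  have hu : Integrable fun x ↦ f (u + x) := hf.comp_add_left u
  have h1 : (DomAddAct.mk u +ᵥ hf.toL1 f) = hu.toL1 _ := rfl
  rw [h1, ← Integrable.toL1_sub, L1.norm_of_fun_eq_integral_norm]
  simp [add_comm u]

variable {φ : ℝ → ℝ}

lemma MeasureTheory.Integrable.hasSum_intervalIntegral_sub_intCast (hφ : Integrable φ) (a : ℝ) :
    HasSum (fun i : ℤ ↦ ∫ x in a..a + 1, φ (x - i)) (∫ x, φ x) := by
  have h := (Equiv.neg ℤ).hasSum_iff.2 (hφ.hasSum_intervalIntegral a)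
  refine h.congr_fun fun i ↦ ?_
  simp [sub_eq_add_neg, add_right_comm]

lemma MeasureTheory.Integrable.summable_intervalIntegral_sub_intCast (hφ : Integrable φ)
    {a b : ℝ} (hab : a ≤ b) : Summable fun i : ℤ ↦ ∫ x in a..b, φ (x - i) := by
  have hint (ψ : ℝ → ℝ) (hψ : Integrable ψ) (i : ℤ) (c d : ℝ) :
      IntervalIntegrable (fun x ↦ ψ (x - i)) volume c d :=
    (hψ.comp_sub_right _).intervalIntegrable
  have hnat (n : ℕ) : Summable fun i : ℤ ↦ ∫ x in a..a + n, |φ (x - i)| := by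
    induction n with
    | zero => simp
    | succ n ih =>
      refine (ih.add (hφ.abs.hasSum_intervalIntegral_sub_intCast (a + n)).summable).congr
        fun i ↦ ?_
      rw [intervalIntegral.integral_add_adjacent_intervals (hint _ hφ.abs i _ _)
        (hint _ hφ.abs i _ _)]
      push_cast
      rw [add_assoc]
  obtain ⟨n, hn⟩ := exists_nat_ge (b - a)
  refine .of_norm_bounded (hnat n) fun i ↦ ?_
  refine (intervalIntegral.norm_integral_le_integral_norm hab).trans ?_
  exact intervalIntegral.integral_mono_interval le_rfl hab (by linarith)
    (.of_forall fun x ↦ abs_nonneg _) (hint _ hφ.abs i _ _)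

/-- The integral over `[a, b]` of the `1`-periodization of `φ`. -/
noncomputable def periodizedIntegral (φ : ℝ → ℝ) (a b : ℝ) : ℝ :=
  ∑' i : ℤ, ∫ x in a..b, φ (x - i)

lemma periodizedIntegral_add_one (hφ : Integrable φ) (a : ℝ) :
    periodizedIntegral φ a (a + 1) = ∫ x, φ x :=
  (hφ.hasSum_intervalIntegral_sub_intCast a).tsum_eq

lemma periodizedIntegral_add_adjacent (hφ : Integrable φ) {a b c : ℝ} (hab : a ≤ b)
    (hbc : b ≤ c) :
    periodizedIntegral φ a b + periodizedIntegral φ b c = periodizedIntegral φ a c := by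
  rw [periodizedIntegral, periodizedIntegral,
    ← (hφ.summable_intervalIntegral_sub_intCast hab).tsum_add
      (hφ.summable_intervalIntegral_sub_intCast hbc)]
  exact tsum_congr fun i ↦ intervalIntegral.integral_add_adjacent_intervals
    (hφ.comp_sub_right _).intervalIntegrable (hφ.comp_sub_right _).intervalIntegrable

lemma periodizedIntegral_nonneg (h0 : 0 ≤ φ) {a b : ℝ} (hab : a ≤ b) :
    0 ≤ periodizedIntegral φ a b :=
  tsum_nonneg fun _ ↦ intervalIntegral.integral_nonneg hab fun _ _ ↦ h0 _

lemma periodizedIntegral_self (a : ℝ) : periodizedIntegral φ a a = 0 := by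
  simp [periodizedIntegral]

lemma periodizedIntegral_mono (hφ : Integrable φ) (h0 : 0 ≤ φ) {a b c : ℝ} (hab : a ≤ b)
    (hbc : b ≤ c) : periodizedIntegral φ a b ≤ periodizedIntegral φ a c := by
  rw [← periodizedIntegral_add_adjacent hφ hab hbc]
  exact le_add_of_nonneg_right (periodizedIntegral_nonneg h0 hbc)

lemma periodizedIntegral_eq_sum_range (hφ : Integrable φ) (a : ℝ) {d : ℝ} (hd : 0 ≤ d) (r : ℕ) :
    periodizedIntegral φ a (a + r * d) =
      ∑ j ∈ Finset.range r, periodizedIntegral φ (a + j * d) (a + j * d + d) := by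
  induction r with
  | zero => simp [periodizedIntegral_self]
  | succ r ih =>
    rw [Finset.sum_range_succ, ← ih, periodizedIntegral_add_adjacent hφ
      (le_add_of_nonneg_right (by positivity)) (le_add_of_nonneg_right hd)]
    congr 1
    push_cast
    ring

lemma abs_periodizedIntegral_translate_sub_le (hφ : Integrable φ) (s : ℝ) {a b : ℝ}
    (hab : a ≤ b) (hb : b ≤ a + 1) :
    |periodizedIntegral φ (a + s) (b + s) - periodizedIntegral φ a b| ≤
      ∫ x, |φ (x + s) - φ x| := by
  set ψ : ℝ → ℝ := fun x ↦ φ (x + s) - φ x with hψdef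
  have hs : Integrable fun x ↦ φ (x + s) := hφ.comp_add_right s
  have hψ : Integrable ψ := hs.sub hφ
  have h1 : periodizedIntegral φ (a + s) (b + s) - periodizedIntegral φ a b =
      ∑' i : ℤ, ∫ x in a..b, ψ (x - i) := by
    rw [periodizedIntegral, periodizedIntegral,
      ← (hφ.summable_intervalIntegral_sub_intCast (by linarith)).tsum_sub
        (hφ.summable_intervalIntegral_sub_intCast hab)]
    refine tsum_congr fun i ↦ ?_
    rw [← intervalIntegral.integral_comp_add_right (fun x ↦ φ (x - i)) s,
      ← intervalIntegral.integral_sub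
      ((hφ.comp_sub_right (i : ℝ)).comp_add_right s).intervalIntegrable
      (hφ.comp_sub_right _).intervalIntegrable]
    simp only [hψdef, sub_add_eq_add_sub]
  rw [h1, ← Real.norm_eq_abs]
  refine tsum_of_norm_bounded (hψ.abs.hasSum_intervalIntegral_sub_intCast a) fun i ↦ ?_
  refine (intervalIntegral.norm_integral_le_integral_norm hab).trans ?_
  exact intervalIntegral.integral_mono_interval le_rfl hab hb
    (.of_forall fun x ↦ abs_nonneg _) (hψ.abs.comp_sub_right _).intervalIntegrable

variable {f : ℝ → ℝ}

/-- The density `f` rescaled by the factor `κ`. -/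
noncomputable def rescaledDensity (f : ℝ → ℝ) (κ x : ℝ) : ℝ := κ⁻¹ * f (x / κ)

lemma integrable_rescaledDensity (hf : Integrable f) {κ : ℝ} (hκ : 0 < κ) :
    Integrable (rescaledDensity f κ) :=
  (hf.comp_div hκ.ne').const_mul _

lemma integral_rescaledDensity (f : ℝ → ℝ) {κ : ℝ} (hκ : 0 < κ) :
    ∫ x, rescaledDensity f κ x = ∫ x, f x := by
  simp only [rescaledDensity]
  rw [integral_const_mul, Measure.integral_comp_div, abs_of_pos hκ, smul_eq_mul,
    inv_mul_cancel_left₀ hκ.ne']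

lemma rescaledDensity_nonneg (h0 : ∀ x, 0 ≤ f x) {κ : ℝ} (hκ : 0 < κ) :
    0 ≤ rescaledDensity f κ :=
  fun _ ↦ mul_nonneg (inv_nonneg.2 hκ.le) (h0 _)

lemma integral_abs_rescaledDensity_translate_sub (f : ℝ → ℝ) {κ : ℝ} (hκ : 0 < κ) (s : ℝ) :
    ∫ x, |rescaledDensity f κ (x + s) - rescaledDensity f κ x| =
      ∫ x, |f (x + s / κ) - f x| := by
  rw [← integral_rescaledDensity (fun x ↦ |f (x + s / κ) - f x|) hκ]
  refine integral_congr_ae (.of_forall fun x ↦ ?_)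
  simp only [rescaledDensity, ← mul_sub, abs_mul, abs_of_pos (inv_pos.2 hκ), add_div]

lemma tendsto_periodizedIntegral_translate_sub (hf : Integrable f) (s : ℝ) {a b : ℝ}
    (hab : a ≤ b) (hb : b ≤ a + 1) :
    Tendsto (fun κ ↦ periodizedIntegral (rescaledDensity f κ) (a + s) (b + s) -
      periodizedIntegral (rescaledDensity f κ) a b) atTop (𝓝 0) := by
  have h := hf.tendsto_integral_abs_translate_sub.comp
    (tendsto_const_nhds.div_atTop tendsto_id : Tendsto (fun κ : ℝ ↦ s / κ) atTop (𝓝 0))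
  refine squeeze_zero_norm' ?_ h
  filter_upwards [eventually_gt_atTop 0] with κ hκ
  exact (abs_periodizedIntegral_translate_sub_le (integrable_rescaledDensity hf hκ) s hab
    hb).trans_eq (integral_abs_rescaledDensity_translate_sub f hκ s)

lemma tendsto_periodizedIntegral_one_div (hf : Integrable f) (hf1 : ∫ x, f x = 1) (a : ℝ) {k : ℕ}
    (hk : k ≠ 0) :
    Tendsto (fun κ ↦ periodizedIntegral (rescaledDensity f κ) a (a + 1 / k)) atTop
      (𝓝 (1 / k)) := by
  have hk0 : (0 : ℝ) < k := by positivity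
  have hk1 : (1 : ℝ) / k ≤ 1 := (div_le_one hk0).2 (by exact_mod_cast Nat.one_le_iff_ne_zero.2 hk)
  have h := tendsto_finsetSum (Finset.range k) fun j _ ↦
    tendsto_periodizedIntegral_translate_sub hf (j * (1 / k : ℝ)) (a := a) (b := a + 1 / k)
      (le_add_of_nonneg_right (by positivity)) (by linarith)
  have h2 := ((tendsto_const_nhds (x := (1 : ℝ))).sub h).div_const (k : ℝ)
  simp only [Finset.sum_const_zero, sub_zero] at h2
  refine h2.congr' ?_
  filter_upwards [eventually_gt_atTop 0] with κ hκ
  have h3 := periodizedIntegral_eq_sum_range (integrable_rescaledDensity hf hκ) a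
    (d := 1 / k) (by positivity) k
  rw [mul_one_div_cancel hk0.ne', periodizedIntegral_add_one (integrable_rescaledDensity hf hκ),
    integral_rescaledDensity f hκ, hf1] at h3
  simp only [Finset.sum_sub_distrib, Finset.sum_const, Finset.card_range, nsmul_eq_mul,
    add_right_comm a (1 / k : ℝ)]
  rw [← h3]
  field_simp
  ring

/-- The periodizations of the rescaled densities equidistribute. -/
theorem tendsto_periodizedIntegral (hf : Integrable f) (h0 : ∀ x, 0 ≤ f x) (hf1 : ∫ x, f x = 1)
    (a : ℝ) {b : ℝ} (hb : 0 ≤ b) :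
    Tendsto (fun κ ↦ periodizedIntegral (rescaledDensity f κ) a (a + b)) atTop (𝓝 b) := by
  have hrat (r : ℕ) {k : ℕ} (hk : k ≠ 0) : Tendsto (fun κ ↦
      periodizedIntegral (rescaledDensity f κ) a (a + r * (1 / k))) atTop (𝓝 (r * (1 / k))) := by
    have h := tendsto_finsetSum (Finset.range r) fun j _ ↦
      tendsto_periodizedIntegral_one_div hf hf1 (a + j * (1 / k)) hk
    simp only [Finset.sum_const, Finset.card_range, nsmul_eq_mul] at h
    refine h.congr' ?_
    filter_upwards [eventually_gt_atTop 0] with κ hκ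
    exact (periodizedIntegral_eq_sum_range (integrable_rescaledDensity hf hκ) a
      (by positivity) r).symm
  have hfloor (n : ℕ) : ∃ r : ℕ, r * (1 / (n + 1 : ℕ) : ℝ) ≤ b ∧
      b < (r + 1 : ℕ) * (1 / (n + 1 : ℕ) : ℝ) := by
    have hn0 : (0 : ℝ) < (n + 1 : ℕ) := by positivity
    refine ⟨⌊b * (n + 1 : ℕ)⌋₊, ?_, ?_⟩
    · rw [mul_one_div, div_le_iff₀ hn0]
      exact Nat.floor_le (mul_nonneg hb hn0.le)
    · rw [mul_one_div, lt_div_iff₀ hn0, Nat.cast_succ ⌊_⌋₊]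
      exact Nat.lt_floor_add_one (b * (n + 1 : ℕ))
  refine tendsto_order.2 ⟨fun c hc ↦ ?_, fun c hc ↦ ?_⟩
  · obtain ⟨n, hn⟩ := exists_nat_one_div_lt (sub_pos.2 hc)
    obtain ⟨r, hr, hr'⟩ := hfloor n
    have hcr : c < r * (1 / (n + 1 : ℕ) : ℝ) := by
      rw [Nat.cast_succ r] at hr'
      rw [← Nat.cast_succ] at hn
      linarith
    filter_upwards [eventually_gt_atTop 0, (hrat r n.succ_ne_zero).eventually_const_lt hcr]
      with κ hκ hlt
    exact hlt.trans_le (periodizedIntegral_mono (integrable_rescaledDensity hf hκ)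
      (rescaledDensity_nonneg h0 hκ) (le_add_of_nonneg_right (by positivity)) (by linarith))
  · obtain ⟨n, hn⟩ := exists_nat_one_div_lt (sub_pos.2 hc)
    obtain ⟨r, hr, hr'⟩ := hfloor n
    have hrc : (r + 1 : ℕ) * (1 / (n + 1 : ℕ) : ℝ) < c := by
      rw [Nat.cast_succ r]
      rw [← Nat.cast_succ] at hn
      linarith
    filter_upwards [eventually_gt_atTop 0, (hrat (r + 1) n.succ_ne_zero).eventually_lt_const hrc]
      with κ hκ hlt
    exact (periodizedIntegral_mono (integrable_rescaledDensity hf hκ)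
      (rescaledDensity_nonneg h0 hκ) (le_add_of_nonneg_right hb) (by linarith)).trans_lt hlt

end Periodization

lemma intervalIntegral_comp_sub_div_eq_rescaledDensity (f : ℝ → ℝ) {lam : ℝ} (hlam : 0 < lam)
    (σ t T : ℝ) (i : ℤ) :
    ∫ x in t..(t + T), (1 / σ) * f ((x - i / lam) / σ) =
      ∫ x in (lam * t)..(lam * t + lam * T), rescaledDensity f (lam * σ) (x - i) := by
  rw [← mul_add, ← intervalIntegral.smul_integral_comp_mul_left, smul_eq_mul,
    ← intervalIntegral.integral_const_mul]
  refine intervalIntegral.integral_congr fun x _ ↦ ?_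
  have h : (lam * x - i) / (lam * σ) = (x - i / lam) / σ := by
    rw [← mul_div_mul_left (x - i / lam) σ hlam.ne', mul_sub, mul_div_cancel₀ _ hlam.ne']
  simp only [rescaledDensity, h, mul_inv, one_div]
  rw [← mul_assoc, mul_inv_cancel_left₀ hlam.ne']

lemma intervalIntegral_comp_sub_div_le {f : ℝ → ℝ} (hf : Continuous f) {M : ℝ}
    (hM : ∀ x, f x ≤ M) {σ : ℝ} (hσ : 0 < σ) (c t : ℝ) {T : ℝ} (hT : 0 ≤ T) :
    ∫ x in t..(t + T), (1 / σ) * f ((x - c) / σ) ≤ T * (M / σ) := by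
  have hcont : Continuous fun x ↦ (1 / σ) * f ((x - c) / σ) := by fun_prop
  have h := intervalIntegral.integral_mono_on (μ := volume)
    (g := fun _ ↦ M / σ) (le_add_of_nonneg_right (a := t) hT)
    (hcont.intervalIntegrable _ _) (continuous_const.intervalIntegrable _ _) fun x _ ↦ by
      rw [one_div_mul_eq_div]
      exact div_le_div_of_nonneg_right (hM _) hσ.le
  rwa [intervalIntegral.integral_const, add_sub_cancel_left, smul_eq_mul] at h

/-- Fix `γ ∈ (0,1]`. In the PSRA process with independent deletion
probability `1-γ`, for each `σ > 0` the events `A^σ_i` = "client `i` arrives in `(t,t+T]`"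
are independent with `P(A^σ_i) = γ·p_i(t,t+T)`, where
`p_i(t,t+T) = ∫_t^{t+T} (1/σ) f_ξ((x-i/λ)/σ) dx`. Let `q_{γ,n}^{(σ)}` be the distribution
of the number of arrivals in `(t,t+T]` and `q_{γ,n} = e^{-γλT}(γλT)^n/n!` the Poisson
distribution of intensity `γλT`. Then `Σ_{n=0}^∞ |q_{γ,n}^{(σ)} - q_{γ,n}| → 0` as `σ → ∞`. -/
theorem psra_deleted_total_variation_convergence {Ω : Type*} [MeasurableSpace Ω]
    (P : ℝ → Measure Ω) [∀ σ, IsProbabilityMeasure (P σ)]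
    (γ lam M : ℝ) (hγ0 : 0 < γ) (hγ1 : γ ≤ 1) (hlam : 0 < lam)
    (f : ℝ → ℝ) (hf_cont : Continuous f) (hf_nonneg : ∀ x, 0 ≤ f x)
    (hf_int : Integrable f) (hf_prob : ∫ x, f x = 1)
    (hf_bdd : ∀ x, f x ≤ M)
    (hf_var : Integrable (fun x => x ^ 2 * f x))
    (t T : ℝ) (hT : 0 < T)
    (A : ℝ → ℤ → Set Ω) (hAmeas : ∀ σ i, MeasurableSet (A σ i))
    (hindep : ∀ σ, 0 < σ → iIndepSet (A σ) (P σ))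
    (hprob : ∀ σ, 0 < σ → ∀ i : ℤ, (P σ) (A σ i) =
      ENNReal.ofReal (γ * ∫ x in t..(t + T), (1 / σ) * f ((x - i / lam) / σ)))
    (N : ℝ → Ω → ℕ∞)
    (hN : ∀ σ ω, N σ ω = ∑' i : ℤ, Set.indicator (A σ i) (fun _ => (1 : ℕ∞)) ω) :
    Tendsto (fun σ : ℝ => ∑' n : ℕ,
        |((P σ) {ω | N σ ω = (n : ℕ∞)}).toReal -
          Real.exp (-(γ * lam * T)) * (γ * lam * T) ^ n / n.factorial|)
      atTop (nhds 0) := by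
  have hreal : ∀ σ, 0 < σ → ∀ i : ℤ, (P σ).real (A σ i) =
      γ * ∫ x in t..(t + T), (1 / σ) * f ((x - i / lam) / σ) := fun σ hσ i ↦ by
    rw [measureReal_def, hprob σ hσ i, ENNReal.toReal_ofReal]
    exact mul_nonneg hγ0.le (intervalIntegral.integral_nonneg (le_add_of_nonneg_right hT.le)
      fun x _ ↦ mul_nonneg (one_div_nonneg.2 hσ.le) (hf_nonneg _))
  have hscale : Tendsto (fun σ : ℝ ↦ lam * σ) atTop atTop := tendsto_id.const_mul_atTop hlam
  have hL : ∀ᶠ σ in atTop, HasSum (fun i ↦ (P σ).real (A σ i))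
      (γ * periodizedIntegral (rescaledDensity f (lam * σ)) (lam * t) (lam * t + lam * T)) := by
    filter_upwards [eventually_gt_atTop 0] with σ hσ
    simp only [hreal σ hσ, intervalIntegral_comp_sub_div_eq_rescaledDensity f hlam]
    exact ((integrable_rescaledDensity hf_int
      (mul_pos hlam hσ)).summable_intervalIntegral_sub_intCast
      (le_add_of_nonneg_right (by positivity))).hasSum.mul_left γ
  have hm : ∀ᶠ σ in atTop, ∀ i, (P σ).real (A σ i) ≤ γ * (T * (M / σ)) := by
    filter_upwards [eventually_gt_atTop 0] with σ hσ i
    rw [hreal σ hσ i]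
    exact mul_le_mul_of_nonneg_left
      (intervalIntegral_comp_sub_div_le hf_cont hf_bdd hσ _ t hT.le) hγ0.le
  have hLr : Tendsto (fun σ ↦ γ * periodizedIntegral (rescaledDensity f (lam * σ)) (lam * t)
      (lam * t + lam * T)) atTop (𝓝 (γ * lam * T)) := by
    rw [mul_assoc]
    exact ((tendsto_periodizedIntegral hf_int hf_nonneg hf_prob (lam * t)
      (mul_pos hlam hT).le).comp hscale).const_mul γ
  have hm0 : Tendsto (fun σ : ℝ ↦ γ * (T * (M / σ))) atTop (𝓝 0) := by
    simpa using ((tendsto_const_nhds.div_atTop tendsto_id).const_mul T).const_mul γ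
  have hind : ∀ᶠ σ in atTop, iIndepSet (A σ) (P σ) := by
    filter_upwards [eventually_gt_atTop 0] with σ hσ using hindep σ hσ
  have hset (σ : ℝ) (n : ℕ) : {ω | N σ ω = (n : ℕ∞)} = {ω | eventCount (A σ) ω = n} := by
    ext ω
    simp only [Set.mem_ofPred_eq, hN]
    exact tsum_indicator_eq_iff_eventCount (A σ) ω n
  simp only [hset]
  exact tendsto_tsum_abs_measureReal_eventCount_sub (by positivity) hAmeas hind hL hm hLr hm0
end
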